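/- Let γ ⊂ ℙ² be an irreducible conic, let r ≥ 2, and let ℓ₁,…,ℓ_r, m₁,…,m_r be pairwise distinct lines all tangent to γ. Let X = 𝕊(ℓ₁,…,ℓ_r) and Y = 𝕊(m₁,…,m_r) be the corresponding contact star configurations on γ. Then X ∪ Y is a complete intersection of type (r−1, r): there exist homogeneous forms F, G ∈ ℂ[x,y,z] of degrees r−1 and r whose common zero locus in ℙ² is exactly X ∪ Y, a set of r(r−1) points. -/

import Mathlib

open MvPolynomial

noncomputable section

abbrev P2 : Type := Projectivization ℂ (Fin 3 → ℂ)

/-- A line in `ℙ²`: the zero locus of a nonzero linear form. -/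
def IsLine (L : Set P2) : Prop :=
  ∃ a : Fin 3 → ℂ, a ≠ 0 ∧ L = {p : P2 | (∑ i, a i * p.rep i) = 0}

/-- An irreducible conic in `ℙ²`: the zero locus of an irreducible homogeneous quadratic form. -/
def IsIrredConic (γ : Set P2) : Prop :=
  ∃ q : MvPolynomial (Fin 3) ℂ, q.IsHomogeneous 2 ∧ Irreducible q ∧
    γ = {p : P2 | eval p.rep q = 0}

/-- `L` is tangent to `γ` : their intersection is a single point. -/
def IsTangent (L γ : Set P2) : Prop := ∃ p : P2, L ∩ γ = {p}

/-- The star configuration defined by a family of lines: the set of points lying on at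
least two of the lines. -/
def starConfig {r : ℕ} (L : Fin r → Set P2) : Set P2 :=
  {p : P2 | ∃ i j : Fin r, i ≠ j ∧ p ∈ L i ∧ p ∈ L j}

/-- A family of lines meets properly: they are distinct lines, no three concurrent. -/
def MeetsProperly {r : ℕ} (L : Fin r → Set P2) : Prop :=
  (∀ i, IsLine (L i)) ∧ Function.Injective L ∧
    ∀ (p : P2) (i j k : Fin r), p ∈ L i → p ∈ L j → p ∈ L k → i = j ∨ i = k ∨ j = k

/-- `W` is a complete intersection of type `(a,b)`. -/
def IsCI (W : Set P2) (a b : ℕ) : Prop :=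
  ∃ F G : MvPolynomial (Fin 3) ℂ, F ≠ 0 ∧ G ≠ 0 ∧
    F.IsHomogeneous a ∧ G.IsHomogeneous b ∧
    {p : P2 | eval p.rep F = 0 ∧ eval p.rep G = 0} = W ∧ W.ncard = a * b

/-- The `ℂ`-submodule of polynomials vanishing at every point of `W`. -/
def vanishingSubmodule (W : Set P2) : Submodule ℂ (MvPolynomial (Fin 3) ℂ) where
  carrier := {F : MvPolynomial (Fin 3) ℂ | ∀ p ∈ W, eval p.rep F = 0}
  add_mem' := by
    intro a b ha hb p hp
    simp only [map_add, ha p hp, hb p hp, add_zero]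
  zero_mem' := by
    intro p hp
    simp
  smul_mem' := by
    intro c F hF p hp
    simp only [smul_eval, hF p hp, mul_zero]

/-- The degree-`d` graded component of the vanishing ideal of `W`. -/
def idealComp (W : Set P2) (d : ℕ) : Submodule ℂ (MvPolynomial (Fin 3) ℂ) :=
  homogeneousSubmodule (Fin 3) ℂ d ⊓ vanishingSubmodule W

/-- The Hilbert function of `W ⊆ ℙ²`. -/
def HF (W : Set P2) (d : ℕ) : ℤ :=
  (Module.finrank ℂ ↥(homogeneousSubmodule (Fin 3) ℂ d) : ℤ) -
    (Module.finrank ℂ ↥(idealComp W d) : ℤ)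

/-- The h-vector of `W ⊆ ℙ²`. -/
def hvec (W : Set P2) : ℕ → ℤ
  | 0 => HF W 0
  | d + 1 => HF W (d + 1) - HF W d

/-- The (affine cone) ideal of a point of `ℙ²`; its powers cut out fat points. -/
def pointIdeal (p : P2) : Ideal (MvPolynomial (Fin 3) ℂ) := RingHom.ker (eval p.rep)

/-- The degree-`d` graded component of a homogeneous ideal `I`. -/
def idealCompI (I : Ideal (MvPolynomial (Fin 3) ℂ)) (d : ℕ) :
    Submodule ℂ (MvPolynomial (Fin 3) ℂ) :=
  homogeneousSubmodule (Fin 3) ℂ d ⊓ Submodule.restrictScalars ℂ I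

/-- The Hilbert function of `S/I`. -/
def HFI (I : Ideal (MvPolynomial (Fin 3) ℂ)) (d : ℕ) : ℤ :=
  (Module.finrank ℂ ↥(homogeneousSubmodule (Fin 3) ℂ d) : ℤ) -
    (Module.finrank ℂ ↥(idealCompI I d) : ℤ)

/-- The h-vector of `S/I`. -/
def hvecI (I : Ideal (MvPolynomial (Fin 3) ℂ)) : ℕ → ℤ
  | 0 => HFI I 0
  | d + 1 => HFI I (d + 1) - HFI I d

/-- The Hadamard-product relation: `R = P ⋆ Q`. -/
def hadRel (P Q R : P2) : Prop :=
  ∃ (u v : Fin 3 → ℂ) (hu : u ≠ 0) (hv : v ≠ 0) (huv : (fun i => u i * v i) ≠ 0),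
    Projectivization.mk ℂ u hu = P ∧ Projectivization.mk ℂ v hv = Q ∧
      Projectivization.mk ℂ (fun i => u i * v i) huv = R

/-- `Δ₀`: points of `ℙ²` with at most one nonzero coordinate. -/
def Δ₀ : Set P2 := {p : P2 | ∃ i : Fin 3, ∀ j : Fin 3, j ≠ i → p.rep j = 0}

/-- The determinant of a pair of vectors of `ℂ²`; it vanishes iff they are proportional. -/
def bracket (s t : Fin 2 → ℂ) : ℂ := s 0 * t 1 - s 1 * t 0

/-- The coefficients of the binary quadratic form `u ↦ [s,u] [t,u]`. -/
def symProd (s t : Fin 2 → ℂ) : Fin 3 → ℂ :=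
  ![s 1 * t 1, -(s 0 * t 1 + s 1 * t 0), s 0 * t 0]

/-- The value at `u` of the binary quadratic form with coefficients `z`. -/
def binaryForm (z : Fin 3 → ℂ) (u : Fin 2 → ℂ) : ℂ :=
  z 0 * u 0 ^ 2 + z 1 * (u 0 * u 1) + z 2 * u 1 ^ 2

/-- The discriminant of the binary quadratic form with coefficients `z`. -/
def binaryDisc (z : Fin 3 → ℂ) : ℂ := z 1 ^ 2 - 4 * z 0 * z 2

theorem fin_two_ne_zero {s : Fin 2 → ℂ} : s ≠ 0 ↔ s 0 ≠ 0 ∨ s 1 ≠ 0 := by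
  rw [← not_iff_not]
  push Not
  exact ⟨fun h => by simp [h], fun h => by ext i; fin_cases i <;> simp [h.1, h.2]⟩

theorem bracket_swap (s t : Fin 2 → ℂ) : bracket s t = -bracket t s := by
  simp only [bracket]; ring

theorem exists_smul_of_bracket_eq_zero {s t : Fin 2 → ℂ} (hs : s ≠ 0) (ht : t ≠ 0)
    (h : bracket s t = 0) : ∃ c : ℂ, c ≠ 0 ∧ t = c • s := by
  simp only [bracket] at h
  have key : ∃ c : ℂ, t = c • s := by
    rcases fin_two_ne_zero.1 hs with h0 | h1
    · refine ⟨t 0 / s 0, ?_⟩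
      ext i; fin_cases i
      · simp [h0]
      · simp only [Fin.mk_one, Pi.smul_apply, smul_eq_mul]; field_simp; linear_combination h
    · refine ⟨t 1 / s 1, ?_⟩
      ext i; fin_cases i
      · simp only [Fin.zero_eta, Pi.smul_apply, smul_eq_mul]; field_simp; linear_combination -h
      · simp [h1]
  obtain ⟨c, rfl⟩ := key
  exact ⟨c, fun hc => ht (by simp [hc]), rfl⟩

theorem bracket_eq_zero_trans {s t u : Fin 2 → ℂ} (ht : t ≠ 0)
    (h₁ : bracket s t = 0) (h₂ : bracket t u = 0) : bracket s u = 0 := by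
  simp only [bracket] at *
  rcases fin_two_ne_zero.1 ht with h | h
  · exact (mul_eq_zero.1 (show t 0 * (s 0 * u 1 - s 1 * u 0) = 0 by
      linear_combination u 0 * h₁ + s 0 * h₂)).resolve_left h
  · exact (mul_eq_zero.1 (show t 1 * (s 0 * u 1 - s 1 * u 0) = 0 by
      linear_combination u 1 * h₁ + s 1 * h₂)).resolve_left h

theorem bracket_eq_zero_trans' {s u v : Fin 2 → ℂ} (hs : s ≠ 0)
    (h₁ : bracket s u = 0) (h₂ : bracket s v = 0) : bracket u v = 0 :=
  bracket_eq_zero_trans hs (by rw [bracket_swap, h₁, neg_zero]) h₂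

theorem binaryForm_symProd (s t u : Fin 2 → ℂ) :
    binaryForm (symProd s t) u = bracket s u * bracket t u := by
  simp [binaryForm, symProd, bracket]; ring

theorem binaryDisc_symProd (s t : Fin 2 → ℂ) :
    binaryDisc (symProd s t) = bracket s t ^ 2 := by
  simp [binaryDisc, symProd, bracket]; ring

theorem binaryForm_smul (c : ℂ) (z : Fin 3 → ℂ) (u : Fin 2 → ℂ) :
    binaryForm (c • z) u = c * binaryForm z u := by
  simp [binaryForm]; ring

theorem binaryDisc_smul (c : ℂ) (z : Fin 3 → ℂ) :
    binaryDisc (c • z) = c ^ 2 * binaryDisc z := by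
  simp [binaryDisc]; ring

theorem symProd_smul_smul (a b : ℂ) (s t : Fin 2 → ℂ) :
    symProd (a • s) (b • t) = (a * b) • symProd s t := by
  ext i; fin_cases i <;> simp [symProd] <;> ring

theorem symProd_comm (s t : Fin 2 → ℂ) : symProd s t = symProd t s := by
  ext i; fin_cases i <;> simp [symProd] <;> ring

/-- A nonzero binary quadratic form over `ℂ` is a product of two nonzero linear forms. -/
theorem exists_eq_symProd {z : Fin 3 → ℂ} (hz : z ≠ 0) :
    ∃ s t : Fin 2 → ℂ, s ≠ 0 ∧ t ≠ 0 ∧ z = symProd s t := by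
  have key : ∃ s t : Fin 2 → ℂ, z = symProd s t := by
    by_cases h0 : z 0 = 0
    · refine ⟨![1, 0], ![z 2, -z 1], ?_⟩
      ext i; fin_cases i <;> simp [symProd, h0]
    · obtain ⟨d, hd⟩ := IsAlgClosed.exists_pow_nat_eq (discrim (z 0) (z 1) (z 2)) two_pos
      obtain ⟨x, hx⟩ := exists_quadratic_eq_zero h0 ⟨d, by rw [← hd, sq]⟩
      refine ⟨![-z 1 - z 0 * x, z 0], ![x, 1], ?_⟩
      ext i; fin_cases i
      · simp [symProd]
      · simp [symProd]
      · simp [symProd]; linear_combination hx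
  obtain ⟨s, t, rfl⟩ := key
  refine ⟨s, t, ?_, ?_, rfl⟩ <;> rintro rfl <;> apply hz <;>
    (ext i; fin_cases i <;> simp [symProd])

theorem symProd_ne_zero {s t : Fin 2 → ℂ} (hs : s ≠ 0) (ht : t ≠ 0) : symProd s t ≠ 0 := by
  intro h
  have h0 := congrFun h 0
  have h1 := congrFun h 1
  have h2 := congrFun h 2
  simp [symProd] at h0 h1 h2
  rcases fin_two_ne_zero.1 hs with a | a <;> rcases fin_two_ne_zero.1 ht with b | b <;>
    simp_all

theorem exists_point_map_rep (Z : (Fin 3 → ℂ) ≃ₗ[ℂ] (Fin 3 → ℂ)) {z : Fin 3 → ℂ} (hz : z ≠ 0) :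
    ∃ p : P2, ∃ c : ℂ, c ≠ 0 ∧ Z p.rep = c • z := by
  have hz' : Z.symm z ≠ 0 := by simpa using hz
  obtain ⟨a, ha⟩ := Projectivization.exists_smul_eq_mk_rep ℂ (Z.symm z) hz'
  refine ⟨Projectivization.mk ℂ _ hz', a, a.ne_zero, ?_⟩
  rw [← ha, Units.smul_def, map_smul, LinearEquiv.apply_symm_apply]

theorem eq_iff_map_rep (Z : (Fin 3 → ℂ) ≃ₗ[ℂ] (Fin 3 → ℂ)) (p p' : P2) :
    p = p' ↔ ∃ a : ℂ, Z p.rep = a • Z p'.rep := by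
  constructor
  · rintro rfl; exact ⟨1, by simp⟩
  · rintro ⟨a, ha⟩
    rw [← p.mk_rep, ← p'.mk_rep, Projectivization.mk_eq_mk_iff']
    exact ⟨a, by apply Z.injective; rw [map_smul, ha]⟩

theorem eq_of_map_rep_eq_smul {Z : (Fin 3 → ℂ) ≃ₗ[ℂ] (Fin 3 → ℂ)} {p p' : P2} {c c' : ℂ}
    {z : Fin 3 → ℂ} (h : Z p.rep = c • z) (hc' : c' ≠ 0) (h' : Z p'.rep = c' • z) : p = p' := by
  rw [eq_iff_map_rep Z]
  exact ⟨c / c', by rw [h, h', smul_smul, div_mul_cancel₀ _ hc']⟩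

theorem map_rep_ne_zero (Z : (Fin 3 → ℂ) ≃ₗ[ℂ] (Fin 3 → ℂ)) (p : P2) : Z p.rep ≠ 0 := by
  simpa using p.rep_nonzero

/-- In coordinates where a conic is the discriminant conic, each tangent line is the locus of
binary quadratic forms vanishing at a fixed point. -/
theorem exists_binaryForm_of_isTangent {Z : (Fin 3 → ℂ) ≃ₗ[ℂ] (Fin 3 → ℂ)} {L : Set P2}
    (hL : IsLine L) (hT : IsTangent L {p : P2 | binaryDisc (Z p.rep) = 0}) :
    ∃ u : Fin 2 → ℂ, u ≠ 0 ∧ L = {p : P2 | binaryForm (Z p.rep) u = 0} := by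
  obtain ⟨a, ha, rfl⟩ := hL
  set f : (Fin 3 → ℂ) →ₗ[ℂ] ℂ := Fintype.linearCombination ℂ a with hf
  have hfa : ∀ x, f x = ∑ i, a i * x i := fun x => by
    simp [hf, Fintype.linearCombination_apply, mul_comm]
  set b : Fin 3 → ℂ := fun i => f (Z.symm (Pi.single i 1)) with hb
  have hfb : ∀ x, f x = ∑ i, b i * Z x i := fun x => by
    have h1 : Z x = ∑ i, Z x i • (Pi.single i 1 : Fin 3 → ℂ) := pi_eq_sum_univ' (Z x)
    have h2 : x = ∑ i, Z x i • Z.symm (Pi.single i 1 : Fin 3 → ℂ) := by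
      apply Z.injective
      simpa using h1
    conv_lhs => rw [h2]
    simp [hb, mul_comm]
  have hb0 : b ≠ 0 := by
    intro h
    apply ha
    ext i
    have := hfb (Pi.single i 1)
    rw [hfa] at this
    simpa [h, Pi.single_apply] using this
  have hset : {p : P2 | (∑ i, a i * p.rep i) = 0} = {p : P2 | ∑ i, b i * Z p.rep i = 0} := by
    ext p; simp only [Set.mem_ofPred_eq, ← hfa, ← hfb]
  rw [hset] at hT ⊢
  have hb0' : (![b 0, 2 * b 1, b 2] : Fin 3 → ℂ) ≠ 0 := by
    intro h
    apply hb0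
    have h0 := congrFun h 0
    have h1 := congrFun h 1
    have h2 := congrFun h 2
    simp at h0 h1 h2
    ext i; fin_cases i <;> simp [h0, h1, h2]
  obtain ⟨α, β, hα, hβ, hαβ⟩ := exists_eq_symProd hb0'
  have e0 : b 0 = α 1 * β 1 := by simpa [symProd] using congrFun hαβ 0
  have e1 : 2 * b 1 = -(α 0 * β 1 + α 1 * β 0) := by simpa [symProd] using congrFun hαβ 1
  have e2 : b 2 = α 0 * β 0 := by simpa [symProd] using congrFun hαβ 2
  have hmem : ∀ s : Fin 2 → ℂ, s ≠ 0 → (α 0 * s 0 + α 1 * s 1) * (β 0 * s 0 + β 1 * s 1) = 0 →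
      ∃ p : P2, p ∈ {p : P2 | ∑ i, b i * Z p.rep i = 0} ∩ {p : P2 | binaryDisc (Z p.rep) = 0} ∧
        ∃ c : ℂ, c ≠ 0 ∧ Z p.rep = c • symProd s s := by
    intro s hs h
    obtain ⟨p, c, hc, hp⟩ := exists_point_map_rep Z (symProd_ne_zero hs hs)
    refine ⟨p, ⟨?_, ?_⟩, c, hc, hp⟩
    · simp only [Set.mem_ofPred_eq, hp, Fin.sum_univ_three]
      simp [symProd]
      linear_combination c * h + c * s 1 ^ 2 * e0 - c * s 0 * s 1 * e1 + c * s 0 ^ 2 * e2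
    · simp only [Set.mem_ofPred_eq, hp, binaryDisc_smul, binaryDisc_symProd]
      simp [bracket]; ring_nf; simp
  have hroot : ∀ v : Fin 2 → ℂ, v ≠ 0 → (![-v 1, v 0] : Fin 2 → ℂ) ≠ 0 := by
    intro v hv
    rw [fin_two_ne_zero] at hv ⊢
    simpa [or_comm] using hv
  obtain ⟨p, hp, c, hc, hpc⟩ := hmem ![-α 1, α 0] (hroot α hα) (by simp; left; ring)
  obtain ⟨p', hp', c', hc', hpc'⟩ := hmem ![-β 1, β 0] (hroot β hβ) (by simp; right; ring)
  obtain ⟨p₀, hp₀⟩ := hT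
  rw [hp₀] at hp hp'
  obtain rfl : p = p' := by rw [Set.mem_singleton_iff.1 hp, Set.mem_singleton_iff.1 hp']
  have hbr : bracket α β = 0 := by
    have h := congrArg (binaryForm · ![-α 1, α 0]) (hpc.symm.trans hpc')
    simp only [binaryForm_smul, binaryForm_symProd] at h
    have h' : bracket ![-α 1, α 0] ![-α 1, α 0] = 0 := by simp [bracket]; ring
    rw [h'] at h
    have h3 : bracket ![-β 1, β 0] ![-α 1, α 0] = 0 := by simpa [hc'] using h.symm
    simp [bracket] at h3 ⊢
    linear_combination -h3
  obtain ⟨k, hk, rfl⟩ := exists_smul_of_bracket_eq_zero hα hβ hbr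
  refine ⟨![α 1, -α 0], ?_, ?_⟩
  · rw [fin_two_ne_zero] at hα ⊢
    simpa [or_comm] using hα
  · ext q
    have : ∑ i, b i * Z q.rep i = k * binaryForm (Z q.rep) ![α 1, -α 0] := by
      simp [Fin.sum_univ_three, binaryForm] at e0 e1 e2 ⊢
      linear_combination Z q.rep 0 * e0 + Z q.rep 1 / 2 * e1 + Z q.rep 2 * e2
    simp only [Set.mem_ofPred_eq, this, mul_eq_zero, hk, false_or]

theorem not_irreducible_mul_of_eval_zero {A B : MvPolynomial (Fin 3) ℂ}
    (hA : eval 0 A = 0) (hB : eval 0 B = 0) : ¬ Irreducible (A * B) := by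
  intro h
  rcases h.isUnit_or_isUnit rfl with h | h
  · exact (h.map (eval (0 : Fin 3 → ℂ))).ne_zero hA
  · exact (h.map (eval (0 : Fin 3 → ℂ))).ne_zero hB

/-- The linear form with the same values as a linear functional. -/
theorem exists_isHomogeneous_one_eval_eq (f : (Fin 3 → ℂ) →ₗ[ℂ] ℂ) :
    ∃ l : MvPolynomial (Fin 3) ℂ, l.IsHomogeneous 1 ∧ ∀ x, eval x l = f x := by
  refine ⟨∑ i, C (f (Pi.single i 1)) * X i, ?_, fun x => ?_⟩
  · exact IsHomogeneous.sum _ _ _ fun i _ => by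
      simpa using (isHomogeneous_C (Fin 3) (f (Pi.single i 1))).mul (isHomogeneous_X ℂ i)
  · conv_rhs => rw [pi_eq_sum_univ' x]
    simp [mul_comm]

theorem exists_linearMap_eq_eval {l : MvPolynomial (Fin 3) ℂ} (hl : l.IsHomogeneous 1) :
    ∃ f : (Fin 3 → ℂ) →ₗ[ℂ] ℂ, ∀ x, f x = eval x l := by
  rw [← mem_homogeneousSubmodule, homogeneousSubmodule_one_eq_span_X] at hl
  induction hl using Submodule.span_induction with
  | mem l h => obtain ⟨i, rfl⟩ := h; exact ⟨LinearMap.proj i, fun x => by simp⟩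
  | zero => exact ⟨0, fun x => by simp⟩
  | add a b _ _ ha hb =>
    obtain ⟨f, hf⟩ := ha
    obtain ⟨g, hg⟩ := hb
    exact ⟨f + g, fun x => by simp [hf, hg]⟩
  | smul c a _ ha =>
    obtain ⟨f, hf⟩ := ha
    exact ⟨c • f, fun x => by simp [hf, smul_eval]⟩

theorem exists_quadraticForm_eq_eval {q : MvPolynomial (Fin 3) ℂ} (hq : q.IsHomogeneous 2) :
    ∃ Q : QuadraticForm ℂ (Fin 3 → ℂ), ∀ x, Q x = eval x q := by
  rw [← mem_homogeneousSubmodule, ← homogeneousSubmodule_one_pow, pow_two] at hq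
  induction hq using Submodule.mul_induction_on' with
  | mem_mul_mem a ha b hb =>
    obtain ⟨f, hf⟩ := exists_linearMap_eq_eval ha
    obtain ⟨g, hg⟩ := exists_linearMap_eq_eval hb
    exact ⟨QuadraticMap.linMulLin f g, fun x => by simp [hf, hg]⟩
  | add a _ b _ ha hb =>
    obtain ⟨f, hf⟩ := ha
    obtain ⟨g, hg⟩ := hb
    exact ⟨f + g, fun x => by simp [hf, hg]⟩

/-- Sum-of-squares coordinates for an irreducible ternary quadratic form over `ℂ`. -/
theorem exists_linearEquiv_sum_sq {q : MvPolynomial (Fin 3) ℂ} (hq : q.IsHomogeneous 2)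
    (hirr : Irreducible q) :
    ∃ Y : (Fin 3 → ℂ) ≃ₗ[ℂ] (Fin 3 → ℂ),
      ∀ x, eval x q = Y x 0 ^ 2 + Y x 1 ^ 2 + Y x 2 ^ 2 := by
  obtain ⟨Q, hQ⟩ := exists_quadraticForm_eq_eval hq
  have hw : ∃ w : Fin 3 → ℂ, QuadraticMap.Equivalent Q (QuadraticMap.weightedSumSquares ℂ w) := by
    have h := QuadraticForm.equivalent_weightedSumSquares Q
    rwa [Module.finrank_fin_fun] at h
  obtain ⟨w, ⟨e⟩⟩ := hw
  choose d hd using fun i => IsAlgClosed.exists_pow_nat_eq (w i) two_pos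
  have hQd : ∀ x, eval x q = (d 0 * e x 0) ^ 2 + (d 1 * e x 1) ^ 2 + (d 2 * e x 2) ^ 2 := by
    intro x
    rw [← hQ, ← e.map_app, QuadraticMap.weightedSumSquares_apply, Fin.sum_univ_three, ← hd, ← hd,
      ← hd]
    simp only [smul_eq_mul]
    ring
  let E : (Fin 3 → ℂ) →ₗ[ℂ] (Fin 3 → ℂ) := e.toLinearEquiv.toLinearMap
  let D : (Fin 3 → ℂ) →ₗ[ℂ] (Fin 3 → ℂ) :=
    LinearMap.pi fun i => d i • (LinearMap.proj i ∘ₗ E)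
  have hD : ∀ x i, D x i = d i * e x i := fun x i => rfl
  have hfac : ∀ i j k : Fin 3, (∀ x, eval x q = D x i ^ 2 + D x j ^ 2 + D x k ^ 2) → d i ≠ 0 := by
    intro i j k h hdi
    obtain ⟨A, -, hA⟩ := exists_isHomogeneous_one_eval_eq
      (LinearMap.proj j ∘ₗ D + Complex.I • (LinearMap.proj k ∘ₗ D))
    obtain ⟨B, -, hB⟩ := exists_isHomogeneous_one_eval_eq
      (LinearMap.proj j ∘ₗ D - Complex.I • (LinearMap.proj k ∘ₗ D))
    refine not_irreducible_mul_of_eval_zero (A := A) (B := B) (by rw [hA, map_zero])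
      (by rw [hB, map_zero]) ?_
    convert hirr
    refine MvPolynomial.funext fun x => ?_
    rw [map_mul, hA, hB, h, hD x i, hdi]
    simp
    linear_combination -(D x k) ^ 2 * Complex.I_sq
  have hne : ∀ i, d i ≠ 0 := by
    intro i
    fin_cases i
    · exact hfac 0 1 2 fun x => by simp only [hQd, hD]
    · exact hfac 1 0 2 fun x => by simp only [hQd, hD]; ring
    · exact hfac 2 0 1 fun x => by simp only [hQd, hD]; ring
  have hinj : Function.Injective D := by
    intro x y hxy
    apply e.toLinearEquiv.injective
    ext i
    have := congrFun hxy i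
    rw [hD, hD] at this
    exact mul_left_cancel₀ (hne i) this
  exact ⟨LinearEquiv.ofInjectiveEndo D hinj, fun x => by
    simp only [LinearEquiv.coe_ofInjectiveEndo, hD, hQd]⟩

/-- Every irreducible conic is the discriminant conic in suitable coordinates. -/
theorem IsIrredConic.exists_binaryDisc {γ : Set P2} (hγ : IsIrredConic γ) :
    ∃ Z : (Fin 3 → ℂ) ≃ₗ[ℂ] (Fin 3 → ℂ), γ = {p : P2 | binaryDisc (Z p.rep) = 0} := by
  obtain ⟨q, hq, hirr, rfl⟩ := hγ
  obtain ⟨Y, hY⟩ := exists_linearEquiv_sum_sq hq hirr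
  let y (i : Fin 3) : (Fin 3 → ℂ) →ₗ[ℂ] ℂ := LinearMap.proj i ∘ₗ Y.toLinearMap
  let D : (Fin 3 → ℂ) →ₗ[ℂ] (Fin 3 → ℂ) := LinearMap.pi
    ![(1 / 2 : ℂ) • (y 0 - Complex.I • y 1), y 2, (-1 / 2 : ℂ) • (y 0 + Complex.I • y 1)]
  have hD0 : ∀ x, D x 0 = (1 / 2 : ℂ) * (Y x 0 - Complex.I * Y x 1) := fun x => rfl
  have hD1 : ∀ x, D x 1 = Y x 2 := fun x => rfl
  have hD2 : ∀ x, D x 2 = (-1 / 2 : ℂ) * (Y x 0 + Complex.I * Y x 1) := fun x => rfl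
  have hinj : Function.Injective D := by
    intro x x' h
    have h0 := congrFun h 0
    have h1 := congrFun h 1
    have h2 := congrFun h 2
    rw [hD0, hD0] at h0
    rw [hD1, hD1] at h1
    rw [hD2, hD2] at h2
    apply Y.injective
    ext i; fin_cases i
    · simp; linear_combination h0 - h2
    · simp; linear_combination Complex.I * (h0 + h2) - (Y x' 1 - Y x 1) * Complex.I_sq
    · exact h1
  refine ⟨LinearEquiv.ofInjectiveEndo D hinj, ?_⟩
  ext p
  have : binaryDisc (D p.rep) = eval p.rep q := by
    rw [binaryDisc, hD0, hD1, hD2, hY]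
    linear_combination -(Y p.rep 1) ^ 2 * Complex.I_sq
  simp only [LinearEquiv.coe_ofInjectiveEndo, Set.mem_ofPred_eq, this]

/-- The rational part `S` and the `√q`-coefficient `D` of `∏ (σ i + c i √q)`, as forms. -/
theorem exists_isHomogeneous_prod_add_sqrt {ι : Type*} [DecidableEq ι]
    {σ : ι → MvPolynomial (Fin 3) ℂ} (c : ι → ℂ) {q : MvPolynomial (Fin 3) ℂ}
    (hσ : ∀ i, (σ i).IsHomogeneous 1) (hq : q.IsHomogeneous 2) (s : Finset ι) :
    ∃ S D : MvPolynomial (Fin 3) ℂ, S.IsHomogeneous s.card ∧ D.IsHomogeneous (s.card - 1) ∧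
      (s = ∅ → D = 0) ∧
      (∀ (x : Fin 3 → ℂ) (δ : ℂ), δ ^ 2 = eval x q →
        eval x S + δ * eval x D = ∏ i ∈ s, (eval x (σ i) + c i * δ)) ∧
      ∀ x : Fin 3 → ℂ, eval x q = 0 →
        eval x D = ∑ i ∈ s, c i * ∏ j ∈ s.erase i, eval x (σ j) := by
  induction s using Finset.induction_on with
  | empty => exact ⟨1, 0, by simpa using isHomogeneous_one _ _, isHomogeneous_zero _ _ _,
      fun _ => rfl, by simp, by simp⟩
  | insert a s ha ih =>
    obtain ⟨S, D, hS, hD, hD0, hSD, hder⟩ := ih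
    refine ⟨S * σ a + C (c a) * (D * q), D * σ a + C (c a) * S, ?_, ?_, by simp, ?_, ?_⟩
    · rw [Finset.card_insert_of_notMem ha]
      refine (hS.mul (hσ a)).add ?_
      rcases s.eq_empty_or_nonempty with rfl | hs
      · rw [hD0 rfl]; simpa using isHomogeneous_zero _ _ _
      · have := (isHomogeneous_C (Fin 3) (c a)).mul (hD.mul hq)
        have h1 := hs.card_pos
        rwa [show 0 + (s.card - 1 + 2) = s.card + 1 by omega] at this
    · rw [Finset.card_insert_of_notMem ha, Nat.add_sub_cancel]
      refine IsHomogeneous.add ?_ (by simpa using (isHomogeneous_C (Fin 3) (c a)).mul hS)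
      rcases s.eq_empty_or_nonempty with rfl | hs
      · rw [hD0 rfl]; simpa using isHomogeneous_zero _ _ _
      · have := hD.mul (hσ a)
        rwa [Nat.sub_add_cancel hs.card_pos] at this
    · intro x δ hδ
      rw [Finset.prod_insert ha, ← hSD x δ hδ]
      simp only [map_add, map_mul, eval_C, ← hδ]
      ring
    · intro x hx
      have hS0 : eval x S = ∏ i ∈ s, eval x (σ i) := by
        simpa using hSD x 0 (by simp [hx])
      rw [Finset.sum_insert ha, Finset.erase_insert ha]
      simp only [map_add, map_mul, eval_C, hder x hx, hS0, Finset.sum_mul]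
      rw [add_comm]
      congr 1
      refine Finset.sum_congr rfl fun i hi => ?_
      have hia : i ≠ a := fun h => ha (h ▸ hi)
      rw [Finset.erase_insert_of_ne hia.symm, Finset.prod_insert (by simp [ha])]
      ring

/-- The forms whose pullbacks to pairs of binary points `(s, t)` are half the sum of
`∏ [s,u i] [t,v i]` and its mirror image, and half their difference divided by `[s,t]`. -/
theorem exists_isHomogeneous_bracket_prod (Z : (Fin 3 → ℂ) ≃ₗ[ℂ] (Fin 3 → ℂ)) {r : ℕ}
    (u v : Fin r → Fin 2 → ℂ) :
    ∃ F G : MvPolynomial (Fin 3) ℂ, F.IsHomogeneous (r - 1) ∧ G.IsHomogeneous r ∧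
      ∀ (x : Fin 3 → ℂ) (s t : Fin 2 → ℂ), Z x = symProd s t →
        eval x G + bracket s t * eval x F = ∏ i, bracket s (u i) * bracket t (v i) ∧
        eval x G - bracket s t * eval x F = ∏ i, bracket t (u i) * bracket s (v i) ∧
        (bracket s t = 0 → eval x F = ∑ i, bracket (u i) (v i) / 2 *
          ∏ j ∈ Finset.univ.erase i, bracket s (u j) * bracket t (v j)) := by
  choose l hl hlx' using fun i => exists_isHomogeneous_one_eval_eq
    (LinearMap.proj i ∘ₗ Z.toLinearMap : (Fin 3 → ℂ) →ₗ[ℂ] ℂ)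
  have hlx : ∀ i x, eval x (l i) = Z x i := hlx'
  have hC : ∀ (a : ℂ) i, (C a * l i).IsHomogeneous 1 := fun a i => by
    simpa using (isHomogeneous_C (Fin 3) a).mul (hl i)
  obtain ⟨G, F, hG, hF, -, hGF, hder⟩ := exists_isHomogeneous_prod_add_sqrt
    (σ := fun i : Fin r => C (u i 0 * v i 0) * l 0 +
      C ((u i 0 * v i 1 + u i 1 * v i 0) / 2) * l 1 + C (u i 1 * v i 1) * l 2)
    (fun i => bracket (u i) (v i) / 2) (q := l 1 ^ 2 - C 4 * l 0 * l 2)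
    (fun i => ((hC _ _).add (hC _ _)).add (hC _ _))
    (((hl 1).pow 2).sub ((hC 4 0).mul (hl 2))) Finset.univ
  rw [Finset.card_univ, Fintype.card_fin] at hG hF
  refine ⟨F, G, hF, hG, fun x s t hst => ?_⟩
  have z0 : eval x (l 0) = s 1 * t 1 := by rw [hlx, hst]; rfl
  have z1 : eval x (l 1) = -(s 0 * t 1 + s 1 * t 0) := by rw [hlx, hst]; rfl
  have z2 : eval x (l 2) = s 0 * t 0 := by rw [hlx, hst]; rfl
  replace hGF := hGF x
  replace hder := hder x
  simp only [map_add, map_sub, map_mul, map_pow, eval_C, z0, z1, z2] at hGF hder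
  refine ⟨?_, ?_, fun h => ?_⟩
  · rw [hGF (bracket s t) (by simp only [bracket]; ring)]
    refine Finset.prod_congr rfl fun i _ => ?_
    simp only [bracket]; ring
  · have := hGF (-bracket s t) (by simp only [bracket]; ring)
    rw [sub_eq_add_neg, ← neg_mul, this]
    refine Finset.prod_congr rfl fun i _ => ?_
    simp only [bracket]; ring
  · rw [hder (by simp only [bracket] at h; linear_combination (s 0 * t 1 - s 1 * t 0) * h)]
    refine Finset.sum_congr rfl fun i _ => ?_
    congr 1
    refine Finset.prod_congr rfl fun j _ => ?_
    simp only [bracket] at h ⊢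
    linear_combination -(u j 0 * v j 1 - u j 1 * v j 0) / 2 * h

/-- The points of the star configuration of tangent lines with pairwise distinct parameters. -/
theorem mem_starConfig_binaryForm_iff {Z : (Fin 3 → ℂ) ≃ₗ[ℂ] (Fin 3 → ℂ)} {r : ℕ}
    {u : Fin r → Fin 2 → ℂ} (hu0 : ∀ i, u i ≠ 0)
    (hu : ∀ i j, bracket (u i) (u j) = 0 → i = j) (p : P2) :
    p ∈ starConfig (fun i => {p : P2 | binaryForm (Z p.rep) (u i) = 0}) ↔
      ∃ i j, i ≠ j ∧ ∃ c : ℂ, c ≠ 0 ∧ Z p.rep = c • symProd (u i) (u j) := by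
  constructor
  · rintro ⟨i, j, hij, hi, hj⟩
    obtain ⟨s, t, hs, ht, hst⟩ := exists_eq_symProd (map_rep_ne_zero Z p)
    simp only [Set.mem_ofPred_eq, hst, binaryForm_symProd, mul_eq_zero] at hi hj
    have key : ∀ s t : Fin 2 → ℂ, s ≠ 0 → t ≠ 0 → bracket s (u i) = 0 → bracket t (u j) = 0 →
        ∃ c : ℂ, c ≠ 0 ∧ symProd s t = c • symProd (u i) (u j) := by
      intro s t hs ht hsi htj
      obtain ⟨a, ha, rfl⟩ := exists_smul_of_bracket_eq_zero (hu0 i) hs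
        (by rw [bracket_swap, hsi, neg_zero])
      obtain ⟨b, hb, rfl⟩ := exists_smul_of_bracket_eq_zero (hu0 j) ht
        (by rw [bracket_swap, htj, neg_zero])
      exact ⟨a * b, mul_ne_zero ha hb, symProd_smul_smul a b _ _⟩
    refine ⟨i, j, hij, ?_⟩
    rw [hst]
    rcases hi with hi | hi <;> rcases hj with hj | hj
    · exact absurd (hu i j (bracket_eq_zero_trans' hs hi hj)) hij
    · exact key s t hs ht hi hj
    · rw [symProd_comm]; exact key t s ht hs hi hj
    · exact absurd (hu i j (bracket_eq_zero_trans' ht hi hj)) hij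
  · rintro ⟨i, j, hij, c, -, h⟩
    have h0 : ∀ a : Fin 2 → ℂ, bracket a a = 0 := fun a => by simp only [bracket]; ring
    exact ⟨i, j, hij, by simp [h, binaryForm_smul, binaryForm_symProd, h0],
      by simp [h, binaryForm_smul, binaryForm_symProd, h0]⟩

theorem ncard_starConfig_union {Z : (Fin 3 → ℂ) ≃ₗ[ℂ] (Fin 3 → ℂ)} {r : ℕ}
    {u v : Fin r → Fin 2 → ℂ} (hu0 : ∀ i, u i ≠ 0) (hv0 : ∀ i, v i ≠ 0)
    (hu : ∀ i j, bracket (u i) (u j) = 0 → i = j) (hv : ∀ i j, bracket (v i) (v j) = 0 → i = j)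
    (huv : ∀ i j, bracket (u i) (v j) ≠ 0) :
    (starConfig (fun i => {p : P2 | binaryForm (Z p.rep) (u i) = 0}) ∪
      starConfig (fun i => {p : P2 | binaryForm (Z p.rep) (v i) = 0})).ncard = (r - 1) * r := by
  choose P c hc hP using fun a : Fin r × Fin r =>
    exists_point_map_rep Z (symProd_ne_zero (hu0 a.1) (hu0 a.2))
  choose Q d hd hQ using fun a : Fin r × Fin r =>
    exists_point_map_rep Z (symProd_ne_zero (hv0 a.1) (hv0 a.2))
  have hself : ∀ a : Fin 2 → ℂ, bracket a a = 0 := fun a => by simp only [bracket]; ring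
  have hPu : ∀ a k, binaryForm (Z (P a).rep) (u k) = 0 ↔ a.1 = k ∨ a.2 = k := by
    intro a k
    rw [hP, binaryForm_smul, binaryForm_symProd, mul_eq_zero, mul_eq_zero]
    simp only [hc, false_or]
    exact or_congr ⟨hu _ _, fun h => h ▸ hself _⟩ ⟨hu _ _, fun h => h ▸ hself _⟩
  have hQv : ∀ a k, binaryForm (Z (Q a).rep) (v k) = 0 ↔ a.1 = k ∨ a.2 = k := by
    intro a k
    rw [hQ, binaryForm_smul, binaryForm_symProd, mul_eq_zero, mul_eq_zero]
    simp only [hd, false_or]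
    exact or_congr ⟨hv _ _, fun h => h ▸ hself _⟩ ⟨hv _ _, fun h => h ▸ hself _⟩
  have hPv : ∀ a k, binaryForm (Z (P a).rep) (v k) ≠ 0 := by
    intro a k
    rw [hP, binaryForm_smul, binaryForm_symProd]
    exact mul_ne_zero (hc a) (mul_ne_zero (huv _ _) (huv _ _))
  have hPQ : ∀ a b, P a ≠ Q b := fun a b h =>
    hPv a b.1 (by rw [h, hQv]; exact Or.inl rfl)
  let f : Fin r × Fin r → P2 := fun a => if a.1 < a.2 then P a else Q a
  have himage : f '' ((Finset.univ : Finset (Fin r)).offDiag : Set (Fin r × Fin r)) =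
      starConfig (fun i => {p : P2 | binaryForm (Z p.rep) (u i) = 0}) ∪
      starConfig (fun i => {p : P2 | binaryForm (Z p.rep) (v i) = 0}) := by
    ext p
    rw [Set.mem_union, mem_starConfig_binaryForm_iff hu0 hu, mem_starConfig_binaryForm_iff hv0 hv]
    constructor
    · rintro ⟨⟨i, j⟩, hij, rfl⟩
      have hij : i ≠ j := by simpa using hij
      by_cases h : i < j
      · exact Or.inl ⟨i, j, hij, c (i, j), hc _, by simp only [f, h, if_true, hP]⟩
      · exact Or.inr ⟨i, j, hij, d (i, j), hd _, by simp only [f, h, if_false, hQ]⟩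
    · rintro (⟨i, j, hij, k, hk, h⟩ | ⟨i, j, hij, k, hk, h⟩)
      · rcases hij.lt_or_gt with hlt | hlt
        · exact ⟨(i, j), by simpa using hij, by
            simp only [f, hlt, if_true]; exact eq_of_map_rep_eq_smul (hP (i, j)) hk h⟩
        · exact ⟨(j, i), by simpa using hij.symm, by
            simp only [f, hlt, if_true]
            exact eq_of_map_rep_eq_smul (hP (j, i)) hk (by rw [h, symProd_comm])⟩
      · rcases hij.lt_or_gt with hlt | hlt
        · exact ⟨(j, i), by simpa using hij.symm, by
            simp only [f, hlt.not_gt, if_false]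
            exact eq_of_map_rep_eq_smul (hQ (j, i)) hk (by rw [h, symProd_comm])⟩
        · exact ⟨(i, j), by simpa using hij, by
            simp only [f, hlt.not_gt, if_false]; exact eq_of_map_rep_eq_smul (hQ (i, j)) hk h⟩
  have hinj : Set.InjOn f ((Finset.univ : Finset (Fin r)).offDiag : Set (Fin r × Fin r)) := by
    rintro ⟨i, j⟩ hij ⟨k, l⟩ hkl h
    have hij : i ≠ j := by simpa using hij
    have hkl : k ≠ l := by simpa using hkl
    by_cases h₁ : i < j <;> by_cases h₂ : k < l <;> simp only [f, h₁, h₂, if_true, if_false] at h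
    · have hk := (hPu (i, j) k).1 (by rw [h, hPu]; exact Or.inl rfl)
      have hl := (hPu (i, j) l).1 (by rw [h, hPu]; exact Or.inr rfl)
      grind
    · exact absurd h (hPQ _ _)
    · exact absurd h.symm (hPQ _ _)
    · have hk := (hQv (i, j) k).1 (by rw [h, hQv]; exact Or.inl rfl)
      have hl := (hQv (i, j) l).1 (by rw [h, hQv]; exact Or.inr rfl)
      grind
  rw [← himage, hinj.ncard_image, Set.ncard_coe_finset, Finset.offDiag_card,
    Finset.card_univ, Fintype.card_fin, Nat.sub_mul, one_mul]

theorem isCI_starConfig_union {Z : (Fin 3 → ℂ) ≃ₗ[ℂ] (Fin 3 → ℂ)} {r : ℕ} (hr : 2 ≤ r)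
    {u v : Fin r → Fin 2 → ℂ} (hu0 : ∀ i, u i ≠ 0) (hv0 : ∀ i, v i ≠ 0)
    (hu : ∀ i j, bracket (u i) (u j) = 0 → i = j) (hv : ∀ i j, bracket (v i) (v j) = 0 → i = j)
    (huv : ∀ i j, bracket (u i) (v j) ≠ 0) :
    IsCI (starConfig (fun i => {p : P2 | binaryForm (Z p.rep) (u i) = 0}) ∪
      starConfig (fun i => {p : P2 | binaryForm (Z p.rep) (v i) = 0})) (r - 1) r := by
  obtain ⟨F, G, hF, hG, hFG⟩ := exists_isHomogeneous_bracket_prod Z u v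
  have hself : ∀ a : Fin 2 → ℂ, bracket a a = 0 := fun a => by simp only [bracket]; ring
  have huv' : ∀ i j, bracket (v j) (u i) ≠ 0 := fun i j h => huv i j (by
    rw [bracket_swap, h, neg_zero])
  have hne : F ≠ 0 ∧ G ≠ 0 := by
    let i₀ : Fin r := ⟨0, by omega⟩
    obtain ⟨h₁, h₂, -⟩ := hFG (Z.symm (symProd (u i₀) (v i₀))) (u i₀) (v i₀)
      (Z.apply_symm_apply _)
    rw [Finset.prod_eq_zero (Finset.mem_univ i₀) (by rw [hself, zero_mul])] at h₁
    have hprod : ∏ i, bracket (v i₀) (u i) * bracket (u i₀) (v i) ≠ 0 :=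
      Finset.prod_ne_zero_iff.2 fun i _ => mul_ne_zero (huv' i i₀) (huv i₀ i)
    rw [← h₂] at hprod
    constructor <;> rintro rfl <;> apply hprod
    · rw [map_zero, mul_zero, add_zero] at h₁
      rw [h₁, map_zero, mul_zero, sub_zero]
    · rw [map_zero, zero_add] at h₁
      rw [h₁, map_zero, sub_zero]
  refine ⟨F, G, hne.1, hne.2, hF, hG, ?_, ncard_starConfig_union hu0 hv0 hu hv huv⟩
  ext p
  rw [Set.mem_union, mem_starConfig_binaryForm_iff hu0 hu, mem_starConfig_binaryForm_iff hv0 hv]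
  constructor
  · rintro ⟨hF0, hG0⟩
    rw [← mem_starConfig_binaryForm_iff hu0 hu, ← mem_starConfig_binaryForm_iff hv0 hv]
    obtain ⟨s, t, hs, ht, hst⟩ := exists_eq_symProd (map_rep_ne_zero Z p)
    obtain ⟨h₁, h₂, h₃⟩ := hFG p.rep s t hst
    rw [hF0, hG0, mul_zero, add_zero] at h₁
    rw [hF0, hG0, mul_zero, sub_zero] at h₂
    obtain ⟨i, -, hi⟩ := Finset.prod_eq_zero_iff.1 h₁.symm
    by_cases hδ : bracket s t = 0
    · exfalso
      have hδ' : bracket t s = 0 := by rw [bracket_swap, hδ, neg_zero]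
      have huniq : ∀ j, bracket s (u j) * bracket t (v j) = 0 → i = j := by
        intro j hj
        rcases mul_eq_zero.1 hi with hi | hi <;> rcases mul_eq_zero.1 hj with hj | hj
        · exact hu _ _ (bracket_eq_zero_trans' hs hi hj)
        · exact absurd (bracket_eq_zero_trans' hs hi (bracket_eq_zero_trans ht hδ hj)) (huv _ _)
        · exact absurd (bracket_eq_zero_trans' ht hi (bracket_eq_zero_trans hs hδ' hj)) (huv' _ _)
        · exact hv _ _ (bracket_eq_zero_trans' ht hi hj)
      have h₄ := h₃ hδ
      rw [hF0, Finset.sum_eq_single i] at h₄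
      · refine mul_ne_zero (div_ne_zero (huv i i) two_ne_zero) ?_ h₄.symm
        exact Finset.prod_ne_zero_iff.2 fun j hj h =>
          Finset.ne_of_mem_erase hj (huniq j h).symm
      · intro k _ hki
        rw [Finset.prod_eq_zero (Finset.mem_erase.2 ⟨hki.symm, Finset.mem_univ i⟩) hi, mul_zero]
      · simp
    · obtain ⟨j, -, hj⟩ := Finset.prod_eq_zero_iff.1 h₂.symm
      have hcontra : ∀ w : Fin 2 → ℂ, w ≠ 0 → bracket s w = 0 → bracket t w = 0 → False :=
        fun w hw h h' => hδ (bracket_eq_zero_trans hw h (by rw [bracket_swap, h', neg_zero]))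
      rcases mul_eq_zero.1 hi with hi | hi <;> rcases mul_eq_zero.1 hj with hj | hj
      · refine Or.inl ⟨i, j, ?_, ?_, ?_⟩
        · rintro rfl; exact hcontra _ (hu0 i) hi hj
        · simp [hst, binaryForm_symProd, hi]
        · simp [hst, binaryForm_symProd, hj]
      · exact absurd (bracket_eq_zero_trans' hs hi hj) (huv _ _)
      · exact absurd (bracket_eq_zero_trans' ht hi hj) (huv' _ _)
      · refine Or.inr ⟨i, j, ?_, ?_, ?_⟩
        · rintro rfl; exact hcontra _ (hv0 i) hj hi
        · simp [hst, binaryForm_symProd, hi]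
        · simp [hst, binaryForm_symProd, hj]
  · have hsolve : ∀ s t : Fin 2 → ℂ, Z p.rep = symProd s t → bracket s t ≠ 0 →
        ∏ i, bracket s (u i) * bracket t (v i) = 0 → ∏ i, bracket t (u i) * bracket s (v i) = 0 →
        eval p.rep F = 0 ∧ eval p.rep G = 0 := by
      intro s t hst hδ ha hb
      obtain ⟨h₁, h₂, -⟩ := hFG p.rep s t hst
      rw [ha] at h₁
      rw [hb] at h₂
      have hG0 : eval p.rep G = 0 := by linear_combination (h₁ + h₂) / 2
      rw [hG0, zero_add] at h₁
      exact ⟨(mul_eq_zero.1 h₁).resolve_left hδ, hG0⟩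
    have hsmul : ∀ (k : ℂ) (a b : Fin 2 → ℂ), bracket (k • a) b = k * bracket a b := fun k a b => by
      simp [bracket]; ring
    have hsymm : ∀ (k : ℂ) (a b : Fin 2 → ℂ), symProd (k • a) b = k • symProd a b := fun k a b => by
      simpa using symProd_smul_smul k 1 a b
    rintro (⟨i, j, hij, k, hk, h⟩ | ⟨i, j, hij, k, hk, h⟩)
    · refine hsolve (k • u i) (u j) (by rw [h, hsymm]) ?_ ?_ ?_
      · rw [hsmul]; exact mul_ne_zero hk fun h => hij (hu _ _ h)
      · exact Finset.prod_eq_zero (Finset.mem_univ i) (by rw [hsmul, hself, mul_zero, zero_mul])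
      · exact Finset.prod_eq_zero (Finset.mem_univ j) (by rw [hself, zero_mul])
    · refine hsolve (k • v i) (v j) (by rw [h, hsymm]) ?_ ?_ ?_
      · rw [hsmul]; exact mul_ne_zero hk fun h => hij (hv _ _ h)
      · exact Finset.prod_eq_zero (Finset.mem_univ j) (by rw [hself, mul_zero])
      · exact Finset.prod_eq_zero (Finset.mem_univ i) (by rw [hsmul, hself, mul_zero, mul_zero])

theorem bracket_ne_zero_of_line_ne {Z : (Fin 3 → ℂ) ≃ₗ[ℂ] (Fin 3 → ℂ)} {a b : Fin 2 → ℂ}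
    (ha : a ≠ 0) (hb : b ≠ 0)
    (h : {p : P2 | binaryForm (Z p.rep) a = 0} ≠ {p : P2 | binaryForm (Z p.rep) b = 0}) :
    bracket a b ≠ 0 := by
  intro h0
  obtain ⟨k, hk, rfl⟩ := exists_smul_of_bracket_eq_zero ha hb h0
  apply h
  ext p
  have : binaryForm (Z p.rep) (k • a) = k ^ 2 * binaryForm (Z p.rep) a := by
    simp [binaryForm]; ring
  simp [this, hk]

/-- **Theorem (e): `X ∪ Y` is a complete intersection of type `(r−1, r)`.**
Let `γ` be an irreducible conic, `r ≥ 2`, and `ℓ₁,…,ℓ_r, m₁,…,m_r` pairwise distinct lines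
tangent to `γ`, defining contact star configurations `X` and `Y`.  Then `X ∪ Y` is a
complete intersection of type `(r−1, r)`, a set of `r(r−1)` points. -/
theorem two_contact_stars_equal_complete_intersection
    (γ : Set P2) (hγ : IsIrredConic γ) (r : ℕ) (hr : 2 ≤ r)
    (ℓ : Fin r → Set P2) (m : Fin r → Set P2)
    (hℓline : ∀ i, IsLine (ℓ i)) (hmline : ∀ j, IsLine (m j))
    (hℓtan : ∀ i, IsTangent (ℓ i) γ) (hmtan : ∀ j, IsTangent (m j) γ)
    (hℓinj : Function.Injective ℓ) (hminj : Function.Injective m)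
    (hcross : ∀ i j, ℓ i ≠ m j) :
    IsCI (starConfig ℓ ∪ starConfig m) (r - 1) r := by
  obtain ⟨Z, rfl⟩ := hγ.exists_binaryDisc
  choose u hu0 hu using fun i => exists_binaryForm_of_isTangent (hℓline i) (hℓtan i)
  choose v hv0 hv using fun i => exists_binaryForm_of_isTangent (hmline i) (hmtan i)
  obtain rfl := funext hu
  obtain rfl := funext hv
  exact isCI_starConfig_union hr hu0 hv0
    (fun i j h => by_contra fun hij =>
      bracket_ne_zero_of_line_ne (hu0 i) (hu0 j) (hℓinj.ne hij) h)
    (fun i j h => by_contra fun hij =>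
      bracket_ne_zero_of_line_ne (hv0 i) (hv0 j) (hminj.ne hij) h)
    fun i j => bracket_ne_zero_of_line_ne (hu0 i) (hv0 j) (hcross i j)
end
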